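/- Let M ≥ 1 and let F ⊆ ℂ be a finite set of cardinality at most M contained in the closed unit disk. Then the support-function integral of F satisfies ∫_0^{2π} max_{w ∈ F} ⟨e^{jθ}, w⟩ dθ ≤ 2·M·sin(π/M). (By Cauchy's surface area formula this integral is the perimeter of convexHull(F), so a convex polygon with M vertices inside the unit circle has perimeter at most 2M·sin(π/M), the perimeter of the inscribed regular M-gon.) -/

import Mathlib

open Complex MeasureTheory

/-- The support function of a set `S ⊆ ℂ` evaluated at the direction `e^{jθ}`:
`sup_{w ∈ S} ⟨e^{jθ}, w⟩ = sup_{w ∈ S} Re(e^{-jθ} w)`. -/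
noncomputable def suppFn (S : Set ℂ) (θ : ℝ) : ℝ :=
  sSup ((fun w => (Complex.exp (-(θ : ℂ) * Complex.I) * w).re) '' S)

/-- The part of `cos` above the level `cos a` has integral `2 sin a - 2 a cos a` over a period. -/
lemma integral_max_cos_sub_cos (a : ℝ) (ha0 : 0 ≤ a) (haπ : a ≤ Real.pi) :
    ∫ t in (-Real.pi)..Real.pi, max (Real.cos t - Real.cos a) 0 =
      2 * Real.sin a - 2 * a * Real.cos a := by
  have hc : Continuous fun t : ℝ => max (Real.cos t - Real.cos a) 0 := by fun_prop
  have hout : ∀ t : ℝ, a ≤ |t| → |t| ≤ Real.pi → max (Real.cos t - Real.cos a) 0 = 0 := by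
    intro t h₁ h₂
    have := Real.cos_le_cos_of_nonneg_of_le_pi ha0 h₂ h₁
    rw [Real.cos_abs] at this
    exact max_eq_right (by linarith)
  have hleft : ∫ t in (-Real.pi)..(-a), max (Real.cos t - Real.cos a) 0 = 0 := by
    rw [intervalIntegral.integral_congr (g := fun _ => (0 : ℝ)), intervalIntegral.integral_zero]
    intro t ht
    rw [Set.uIcc_of_le (by linarith)] at ht
    have : |t| = -t := abs_of_nonpos (by linarith [ht.2])
    exact hout t (by linarith [ht.2]) (by linarith [ht.1])
  have hright : ∫ t in a..Real.pi, max (Real.cos t - Real.cos a) 0 = 0 := by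
    rw [intervalIntegral.integral_congr (g := fun _ => (0 : ℝ)), intervalIntegral.integral_zero]
    intro t ht
    rw [Set.uIcc_of_le haπ] at ht
    have : |t| = t := abs_of_nonneg (by linarith [ht.1])
    exact hout t (by linarith [ht.1]) (by linarith [ht.2])
  have hmid : ∫ t in (-a)..a, max (Real.cos t - Real.cos a) 0 =
      2 * Real.sin a - 2 * a * Real.cos a := by
    rw [intervalIntegral.integral_congr (g := fun t => Real.cos t - Real.cos a)]
    · rw [intervalIntegral.integral_sub (Real.continuous_cos.intervalIntegrable _ _)
        intervalIntegrable_const, integral_cos, intervalIntegral.integral_const, Real.sin_neg,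
        smul_eq_mul]
      ring
    · intro t ht
      rw [Set.uIcc_of_le (by linarith)] at ht
      have := Real.cos_le_cos_of_nonneg_of_le_pi (abs_nonneg t) haπ (abs_le.2 ht)
      rw [Real.cos_abs] at this
      exact max_eq_left (by linarith)
  have hi := fun x y => hc.intervalIntegrable (μ := volume) x y
  rw [← intervalIntegral.integral_add_adjacent_intervals (hi (-Real.pi) (-a)) (hi (-a) Real.pi),
    ← intervalIntegral.integral_add_adjacent_intervals (hi (-a) a) (hi a Real.pi), hleft, hmid, hright]
  ring

/-- Among the subsets of the circle of given measure, arcs maximize the integral of a cosine. -/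
lemma setIntegral_cos_sub_le (A : Set ℝ) (hA : A ⊆ Set.Ioc 0 (2 * Real.pi)) (φ : ℝ) :
    ∫ θ in A, Real.cos (θ - φ) ≤ 2 * Real.sin (volume.real A / 2) := by
  set a := volume.real A / 2 with ha
  have hvol : volume A ≠ ⊤ := measure_ne_top_of_subset hA measure_Ioc_lt_top.ne
  have ha0 : 0 ≤ a := by positivity
  have haπ : a ≤ Real.pi := by
    have := measureReal_mono (μ := volume) hA measure_Ioc_lt_top.ne
    rw [Real.volume_real_Ioc_of_le (by positivity)] at this
    linarith
  have hc : Continuous fun θ : ℝ => max (Real.cos (θ - φ) - Real.cos a) 0 := by fun_prop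
  have hI : IntegrableOn (fun θ : ℝ => max (Real.cos (θ - φ) - Real.cos a) 0)
      (Set.Ioc 0 (2 * Real.pi)) := hc.integrableOn_Ioc
  have hconst : IntegrableOn (fun _ : ℝ => Real.cos a) A := integrableOn_const hvol
  have hcos : IntegrableOn (fun θ : ℝ => Real.cos (θ - φ)) A :=
    IntegrableOn.mono_set (Continuous.integrableOn_Ioc (by fun_prop)) hA
  have hper : Function.Periodic (fun t : ℝ => max (Real.cos t - Real.cos a) 0)
      (2 * Real.pi) := fun t => by simp
  calc ∫ θ in A, Real.cos (θ - φ)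
      ≤ ∫ θ in A, (Real.cos a + max (Real.cos (θ - φ) - Real.cos a) 0) := by
        refine integral_mono hcos (hconst.add (hI.mono_set hA)) fun θ => ?_
        have := le_max_left (Real.cos (θ - φ) - Real.cos a) 0
        dsimp only
        linarith
    _ = 2 * a * Real.cos a + ∫ θ in A, max (Real.cos (θ - φ) - Real.cos a) 0 := by
        rw [integral_add hconst (hI.mono_set hA), setIntegral_const, smul_eq_mul, ha]
        ring
    _ ≤ 2 * a * Real.cos a +
          ∫ θ in Set.Ioc 0 (2 * Real.pi), max (Real.cos (θ - φ) - Real.cos a) 0 := by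
        refine add_le_add_right ?_ _
        exact setIntegral_mono_set hI (ae_of_all _ fun θ => le_max_right _ (0 : ℝ))
          (LE.le.eventuallyLE hA)
    _ = 2 * Real.sin a := by
        rw [← intervalIntegral.integral_of_le (by positivity),
          intervalIntegral.integral_comp_sub_right
            (fun t => max (Real.cos t - Real.cos a) 0) φ,
          show 2 * Real.pi - φ = (0 - φ) + 2 * Real.pi by ring,
          hper.intervalIntegral_add_eq (0 - φ) (-Real.pi),
          show -Real.pi + 2 * Real.pi = Real.pi by ring,
          integral_max_cos_sub_cos a ha0 haπ]
        ring

lemma re_exp_neg_mul_I_mul (w : ℂ) (θ : ℝ) :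
    (Complex.exp (-(θ : ℂ) * Complex.I) * w).re = ‖w‖ * Real.cos (θ - w.arg) := by
  conv_lhs => rw [← Complex.norm_mul_exp_arg_mul_I w, mul_left_comm, ← Complex.exp_add,
    ← add_mul, Complex.re_ofReal_mul]
  rw [← Complex.ofReal_neg, ← Complex.ofReal_add, Complex.exp_ofReal_mul_I_re,
    ← Real.cos_neg]
  ring_nf

lemma continuous_re_exp_neg_mul_I_mul (w : ℂ) :
    Continuous fun θ : ℝ => (Complex.exp (-(θ : ℂ) * Complex.I) * w).re := by
  fun_prop

lemma setIntegral_re_exp_mul_le (A : Set ℝ) (hA : A ⊆ Set.Ioc 0 (2 * Real.pi)) (w : ℂ)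
    (hw : ‖w‖ ≤ 1) :
    ∫ θ in A, (Complex.exp (-(θ : ℂ) * Complex.I) * w).re ≤
      2 * Real.sin (volume.real A / 2) := by
  have hm := measureReal_mono (μ := volume) hA measure_Ioc_lt_top.ne
  rw [Real.volume_real_Ioc_of_le (by positivity)] at hm
  have hsin : 0 ≤ Real.sin (volume.real A / 2) :=
    Real.sin_nonneg_of_nonneg_of_le_pi (by positivity) (by linarith)
  simp_rw [re_exp_neg_mul_I_mul]
  rw [integral_const_mul]
  calc ‖w‖ * ∫ θ in A, Real.cos (θ - w.arg)
      ≤ ‖w‖ * (2 * Real.sin (volume.real A / 2)) := by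
        gcongr
        exact setIntegral_cos_sub_le A hA _
    _ ≤ 2 * Real.sin (volume.real A / 2) := mul_le_of_le_one_left (by positivity) hw

/-- Jensen's inequality for the sine of `M` half-angles with total angle `2π`. -/
lemma sum_sin_half_le (M : ℕ) (hM : 1 ≤ M) (m : Fin M → ℝ) (h0 : ∀ i, 0 ≤ m i)
    (hsum : ∑ i, m i = 2 * Real.pi) :
    ∑ i, 2 * Real.sin (m i / 2) ≤ 2 * M * Real.sin (Real.pi / M) := by
  have hM0 : (0 : ℝ) < M := by exact_mod_cast hM
  have hle : ∀ i, m i ≤ 2 * Real.pi := fun i =>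
    hsum ▸ Finset.single_le_sum (fun j _ => h0 j) (Finset.mem_univ i)
  have key := strictConcaveOn_sin_Icc.concaveOn.le_map_sum (t := Finset.univ)
    (w := fun _ : Fin M => (M : ℝ)⁻¹) (p := fun i => m i / 2) (fun _ _ => by positivity)
    (by simp [hM0.ne']) (fun i _ => ⟨by linarith [h0 i], by linarith [hle i]⟩)
  simp only [smul_eq_mul] at key
  rw [← Finset.mul_sum, ← Finset.mul_sum, ← Finset.sum_div, hsum,
    show (M : ℝ)⁻¹ * (2 * Real.pi / 2) = Real.pi / M by ring, inv_mul_le_iff₀ hM0] at key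
  rw [← Finset.mul_sum]
  linarith

/-- A finite family of points of the closed unit disk, one of which attains the support function
in each direction, bounds the support-function integral. -/
lemma integral_suppFn_le_of_attained (M : ℕ) (hM : 1 ≤ M) (S : Set ℂ) (p : Fin M → ℂ)
    (hp : ∀ i, ‖p i‖ ≤ 1) (hmeas : Measurable (suppFn S))
    (hatt : ∀ θ, ∃ i, suppFn S θ = (Complex.exp (-(θ : ℂ) * Complex.I) * p i).re) :
    (∫ θ in (0 : ℝ)..(2 * Real.pi), suppFn S θ) ≤ 2 * M * Real.sin (Real.pi / M) := by
  set B : Fin M → Set ℝ := fun i => Set.Ioc 0 (2 * Real.pi) ∩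
    {θ | suppFn S θ = (Complex.exp (-(θ : ℂ) * Complex.I) * p i).re} with hB
  have hBm : ∀ i, MeasurableSet (B i) := fun i => measurableSet_Ioc.inter
    (measurableSet_eq_fun hmeas (continuous_re_exp_neg_mul_I_mul _).measurable)
  set A := disjointed B with hA
  have hAB : ∀ i, A i ⊆ B i := disjointed_subset B
  have hAm : ∀ i, MeasurableSet (A i) := fun i =>
    disjointedRec (fun _ j ht => ht.diff (hBm j)) (hBm i)
  have hAd : Pairwise (Function.onFun Disjoint A) := disjoint_disjointed B
  have hAI : ∀ i, A i ⊆ Set.Ioc 0 (2 * Real.pi) := fun i =>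
    (hAB i).trans Set.inter_subset_left
  have hAU : ⋃ i, A i = Set.Ioc 0 (2 * Real.pi) := by
    rw [hA, iUnion_disjointed, hB, ← Set.inter_iUnion, Set.inter_eq_left]
    intro θ _
    exact Set.mem_iUnion.2 (hatt θ)
  have heq : ∀ i, Set.EqOn (suppFn S)
      (fun θ => (Complex.exp (-(θ : ℂ) * Complex.I) * p i).re) (A i) :=
    fun i θ hθ => (hAB i hθ).2
  have hint : ∀ i, IntegrableOn (suppFn S) (A i) := fun i =>
    IntegrableOn.congr_fun (((continuous_re_exp_neg_mul_I_mul _).integrableOn_Ioc).mono_set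
      (hAI i)) (heq i).symm (hAm i)
  have hvol : ∑ i, volume.real (A i) = 2 * Real.pi := by
    have hone := integral_iUnion_fintype (μ := volume) (f := fun _ => (1 : ℝ)) hAm hAd
      (fun i => integrableOn_const (measure_ne_top_of_subset (hAI i) measure_Ioc_lt_top.ne))
    rw [hAU] at hone
    simp only [setIntegral_const, smul_eq_mul, mul_one] at hone
    rw [← hone, Real.volume_real_Ioc_of_le (by positivity), sub_zero]
  rw [intervalIntegral.integral_of_le (by positivity), ← hAU,
    integral_iUnion_fintype hAm hAd hint]
  refine le_trans (Finset.sum_le_sum fun i _ => ?_)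
    (sum_sin_half_le M hM (fun i => volume.real (A i)) (fun i => measureReal_nonneg) hvol)
  rw [setIntegral_congr_fun (hAm i) (heq i)]
  exact setIntegral_re_exp_mul_le _ (hAI i) _ (hp i)

lemma suppFn_finset (F : Finset ℂ) (hF : F.Nonempty) (θ : ℝ) :
    suppFn (F : Set ℂ) θ =
      F.sup' hF (fun w => (Complex.exp (-(θ : ℂ) * Complex.I) * w).re) :=
  (Finset.sup'_eq_csSup_image F hF _).symm

theorem stmt16 (M : ℕ) (hM : 1 ≤ M) (F : Finset ℂ) (hFne : F.Nonempty)
    (hFcard : F.card ≤ M) (hFd : (F : Set ℂ) ⊆ Metric.closedBall 0 1) :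
    (∫ θ in (0 : ℝ)..(2 * Real.pi), suppFn (F : Set ℂ) θ) ≤
      2 * M * Real.sin (Real.pi / M) := by
  have : Nonempty F := hFne.to_subtype
  obtain ⟨e⟩ : Nonempty (F ↪ Fin M) :=
    Function.Embedding.nonempty_of_card_le (by simpa using hFcard)
  have hsurj := Function.invFun_surjective e.injective
  set q : Fin M → F := Function.invFun e
  have hcont : Continuous (suppFn (F : Set ℂ)) := by
    rw [funext (suppFn_finset F hFne)]
    exact Continuous.finset_sup'_apply hFne fun w _ => continuous_re_exp_neg_mul_I_mul w
  refine integral_suppFn_le_of_attained M hM F (fun i => (q i : ℂ))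
    (fun i => by simpa using hFd (q i).2) hcont.measurable fun θ => ?_
  obtain ⟨w, hw, h⟩ := Finset.exists_mem_eq_sup' hFne
    (fun w => (Complex.exp (-(θ : ℂ) * Complex.I) * w).re)
  obtain ⟨i, hi⟩ := hsurj ⟨w, hw⟩
  exact ⟨i, by rw [suppFn_finset F hFne, h, hi]⟩
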